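/- Let S_l(u) = Σ_{n=0}^l u^n/n! denote the partial sums of the exponential series. Then for every m ∈ ℕ and all x, t ∈ ℝ, the partial sums of Hermite polynomials satisfy q_m(x;t) = Σ_{k=0}^{⌊m/2⌋} ((−1)^k·t^{2k}/k!) · S_{m−2k}(2xt). -/

import Mathlib

open Polynomial Finset

/-- The physicists' Hermite polynomials:
`H_0 = 1`, `H_1(x) = 2x`, `H_{n+2}(x) = 2x·H_{n+1}(x) − 2(n+1)·H_n(x)`. -/
noncomputable def hermiteH : ℕ → Polynomial ℝ
  | 0 => 1
  | 1 => Polynomial.C 2 * Polynomial.X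
  | n + 2 => Polynomial.C 2 * Polynomial.X * hermiteH (n + 1)
      - Polynomial.C (2 * ((n : ℝ) + 1)) * hermiteH n

/-- Partial sums of Hermite polynomials `q_m(x;t) = Σ_{n=0}^m (t^n/n!)·H_n(x)`. -/
noncomputable def hermitePS (m : ℕ) (x t : ℝ) : ℝ :=
  ∑ n ∈ Finset.range (m + 1), t ^ n / n.factorial * (hermiteH n).eval x

/-- Partial sums of the exponential series `S_l(u) = Σ_{n=0}^l u^n/n!`. -/
noncomputable def expPS (l : ℕ) (u : ℝ) : ℝ :=
  ∑ n ∈ Finset.range (l + 1), u ^ n / n.factorial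

noncomputable def hermE (t : ℝ) : PowerSeries ℝ :=
  PowerSeries.mk fun i => if Even i then (-1 : ℝ) ^ (i/2) * t ^ (2 * (i/2)) / (i/2).factorial else 0

noncomputable def hermG (u : ℝ) : PowerSeries ℝ :=
  PowerSeries.mk fun i => u ^ i / i.factorial

lemma hermE_rec (t : ℝ) (n : ℕ) :
    PowerSeries.coeff (n+2) (hermE t) * ((n:ℝ) + 2) = -2 * t^2 * PowerSeries.coeff n (hermE t) := by
  simp only [hermE, PowerSeries.coeff_mk]
  rcases Nat.even_or_odd' n with ⟨k, rfl | rfl⟩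
  · have h1 : Even (2*k+2) := ⟨k+1, by ring⟩
    have h2 : Even (2*k) := ⟨k, by ring⟩
    have h3 : (2*k+2)/2 = k+1 := by omega
    have h4 : (2*k)/2 = k := by omega
    rw [if_pos h1, if_pos h2, h3, h4, Nat.factorial_succ]
    have : (k.factorial : ℝ) ≠ 0 := by positivity
    have : (k : ℝ) + 1 ≠ 0 := by positivity
    push_cast
    field_simp
    ring
  · have h1 : ¬ Even (2*k+1+2) := by rw [Nat.not_even_iff_odd]; exact ⟨k+1, by ring⟩
    have h2 : ¬ Even (2*k+1) := by rw [Nat.not_even_iff_odd]; exact ⟨k, by ring⟩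
    rw [if_neg h1, if_neg h2]; simp

lemma hermE_deriv (t : ℝ) :
    PowerSeries.derivative ℝ (hermE t) = PowerSeries.C (-2 * t^2) * (PowerSeries.X * hermE t) := by
  ext n
  rw [PowerSeries.coeff_derivative, PowerSeries.coeff_C_mul]
  cases n with
  | zero => simp [hermE]
  | succ n =>
    rw [PowerSeries.coeff_succ_X_mul, ← hermE_rec]
    push_cast; ring

lemma hermG_deriv (u : ℝ) :
    PowerSeries.derivative ℝ (hermG u) = PowerSeries.C u * hermG u := by
  ext n
  rw [PowerSeries.coeff_derivative, PowerSeries.coeff_C_mul]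
  simp only [hermG, PowerSeries.coeff_mk, Nat.factorial_succ]
  have : (n.factorial : ℝ) ≠ 0 := by positivity
  have : (n : ℝ) + 1 ≠ 0 := by positivity
  push_cast
  field_simp
  ring

lemma hermEG_deriv (t u : ℝ) :
    PowerSeries.derivative ℝ (hermE t * hermG u) =
      PowerSeries.C (-2 * t^2) * (PowerSeries.X * (hermE t * hermG u))
        + PowerSeries.C u * (hermE t * hermG u) := by
  rw [Derivation.leibniz, hermE_deriv, hermG_deriv]
  simp only [smul_eq_mul]
  ring

lemma herm_coeff (x t : ℝ) (n : ℕ) :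
    t ^ n / n.factorial * (hermiteH n).eval x
      = PowerSeries.coeff n (hermE t * hermG (2*x*t)) := by
  induction n using Nat.twoStepInduction with
  | zero => simp [hermiteH, hermE, hermG]
  | one =>
    have h := congrArg (PowerSeries.coeff 0) (hermEG_deriv t (2*x*t))
    rw [PowerSeries.coeff_derivative] at h
    simp [hermE, hermG] at h
    simp [hermiteH, hermE, hermG, h]
    ring
  | more n h0 h1 =>
    have h := congrArg (PowerSeries.coeff (n+1)) (hermEG_deriv t (2*x*t))
    rw [PowerSeries.coeff_derivative, map_add, PowerSeries.coeff_C_mul, PowerSeries.coeff_C_mul,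
      PowerSeries.coeff_succ_X_mul, ← h0, ← h1] at h
    have e : ((n:ℝ) + 1 + 1) ≠ 0 := by positivity
    push_cast at h
    rw [← eq_div_iff e] at h
    rw [h]
    simp only [hermiteH, Nat.factorial_succ, eval_sub, eval_mul, eval_C, eval_X]
    have : (n.factorial : ℝ) ≠ 0 := by positivity
    have : (n : ℝ) + 1 ≠ 0 := by positivity
    push_cast
    field_simp
    ring

lemma herm_coeff_sum (t u : ℝ) (n : ℕ) :
    PowerSeries.coeff n (hermE t * hermG u) =
      ∑ k ∈ Finset.range (n / 2 + 1),
        (-1 : ℝ) ^ k * t ^ (2 * k) / k.factorial * (u ^ (n - 2*k) / (n-2*k).factorial) := by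
  rw [PowerSeries.coeff_mul, Finset.Nat.sum_antidiagonal_eq_sum_range_succ_mk]
  symm
  apply Finset.sum_of_injOn (fun k => 2 * k)
  · intro a _ b _ h
    simpa using h
  · intro a h
    simp only [Finset.coe_range, Set.mem_Iio] at h ⊢
    omega
  · intro i _ h
    have : ¬ Even i := by
      rintro ⟨k, rfl⟩
      apply h
      refine ⟨k, ?_, by simp; ring⟩
      simp at *
      omega
    simp [hermE, this]
  · intro k _
    simp [hermE, hermG]

/-- for every `m ∈ ℕ` and all `x, t ∈ ℝ`,
`q_m(x;t) = Σ_{k=0}^{⌊m/2⌋} ((−1)^k t^{2k}/k!) · S_{m−2k}(2xt)`. -/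
theorem hermitePS_as_combination_of_expPS (m : ℕ) (x t : ℝ) :
    hermitePS m x t =
      ∑ k ∈ Finset.range (m / 2 + 1),
        (-1 : ℝ) ^ k * t ^ (2 * k) / k.factorial * expPS (m - 2 * k) (2 * x * t) := by
  unfold hermitePS expPS
  simp only [herm_coeff, herm_coeff_sum]
  rw [Finset.sum_comm' (t' := Finset.range (m/2+1)) (s' := fun k => Finset.Ico (2*k) (m+1))]
  · refine Finset.sum_congr rfl fun k hk => ?_
    rw [Finset.mem_range] at hk
    rw [Finset.sum_Ico_eq_sum_range, Finset.mul_sum]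
    have : m + 1 - 2*k = m - 2*k + 1 := by omega
    rw [this]
    simp
  · intro a b
    simp only [Finset.mem_range, Finset.mem_Ico]
    omega
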